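/- Fix game G_i and suppose the Eater plays π^{E*}. If π^M is any admissible Mover strategy whose resulting path is a shortest path from p(0) to g_i (of length d(p(0),g_i) = n^a(p(0)) + n^r_i(p(0))), then J_i(π^{M*}_i, π^{E*}) ≤ J_i(π^M, π^{E*}); i.e., among shortest paths, performing all n^a(p(0)) ambiguous moves before the n^r_i(p(0)) explicit moves minimizes the consumption at the true goal, so the Mover has no incentive to deviate from making all ambiguous moves first. -/

import Mathlib

noncomputable section

open Classical

/-- Manhattan distance on the grid ℤ². -/
def mdist (p q : ℤ × ℤ) : ℤ := |p.1 - q.1| + |p.2 - q.2|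

/-- The four admissible unit moves of the Mover. -/
def IsUnitMove (e : ℤ × ℤ) : Prop :=
  e = (1, 0) ∨ e = (-1, 0) ∨ e = (0, 1) ∨ e = (0, -1)

/-- The Eater action that eats one banana from goal `j`. -/
def eatOne (j : Fin 2) : Fin 2 → ℝ := fun k => if k = j then 1 else 0

/-- The Eater action that eats half a banana from each goal. -/
def eatHalf : Fin 2 → ℝ := fun _ => 1 / 2

/-- The three admissible Eater actions. -/
def IsEaterAction (a : Fin 2 → ℝ) : Prop :=
  a = eatOne 0 ∨ a = eatOne 1 ∨ a = eatHalf

/-- A Mover strategy: maps (position, consumption vector) to a move. -/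
abbrev MoverStrategy : Type := ℤ × ℤ → (Fin 2 → ℝ) → ℤ × ℤ

/-- An Eater strategy: maps (new Mover position, last Mover move, current consumption)
to an Eater action; it is the same in both games. -/
abbrev EaterStrategy : Type := ℤ × ℤ → ℤ × ℤ → (Fin 2 → ℝ) → Fin 2 → ℝ

def ValidMover (piM : MoverStrategy) : Prop := ∀ p b, IsUnitMove (piM p b)

def ValidEater (piE : EaterStrategy) : Prop := ∀ p a b, IsEaterAction (piE p a b)

/-- State trajectory (position, consumption vector) of the game under a strategy pair:
`p(t+1) = p(t) + a^M(t)`, `b(t+1) = b(t) + a^E(t)`. -/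
def traj (piM : MoverStrategy) (piE : EaterStrategy) (p0 : ℤ × ℤ) (b0 : Fin 2 → ℝ) :
    ℕ → (ℤ × ℤ) × (Fin 2 → ℝ)
  | 0 => (p0, b0)
  | t + 1 =>
    let s := traj piM piE p0 b0 t
    let m := piM s.1 s.2
    (s.1 + m, fun j => s.2 j + piE (s.1 + m) m s.2 j)

/-- Termination time of game `G_i`: the first time the Mover's position equals `goal`. -/
def hitTime (piM : MoverStrategy) (piE : EaterStrategy) (p0 : ℤ × ℤ) (b0 : Fin 2 → ℝ)
    (goal : ℤ × ℤ) : ℕ :=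
  sInf {t | (traj piM piE p0 b0 t).1 = goal}

/-- The outcome `J_i` of game `G_i`: consumption at the true goal `g i` at termination. -/
def outcome (g : Fin 2 → ℤ × ℤ) (i : Fin 2) (piM : MoverStrategy) (piE : EaterStrategy)
    (p0 : ℤ × ℤ) (b0 : Fin 2 → ℝ) : ℝ :=
  (traj piM piE p0 b0 (hitTime piM piE p0 b0 (g i))).2 i

/-- Admissibility: the Mover reaches the goal in finite time. -/
def Reaches (piM : MoverStrategy) (piE : EaterStrategy) (p0 : ℤ × ℤ) (b0 : Fin 2 → ℝ)
    (goal : ℤ × ℤ) : Prop :=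
  ∃ t, (traj piM piE p0 b0 t).1 = goal

/-- A step from `p` to `p'` is ambiguous: `δd₁ = δd₂`. -/
def IsAmbStep (g : Fin 2 → ℤ × ℤ) (p p' : ℤ × ℤ) : Prop :=
  mdist p' (g 0) - mdist p (g 0) = mdist p' (g 1) - mdist p (g 1)

/-- A step from `p` to `p'` is explicit: `δd₁ = −δd₂`. -/
def IsExpStep (g : Fin 2 → ℤ × ℤ) (p p' : ℤ × ℤ) : Prop :=
  mdist p' (g 0) - mdist p (g 0) = -(mdist p' (g 1) - mdist p (g 1))

/-- A path of `T` unit moves from `p` to `goal`. -/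
def IsPath (p goal : ℤ × ℤ) (T : ℕ) (q : ℕ → ℤ × ℤ) : Prop :=
  q 0 = p ∧ q T = goal ∧ ∀ t < T, IsUnitMove (q (t + 1) - q t)

/-- Number of ambiguous moves along a path. -/
def ambCount (g : Fin 2 → ℤ × ℤ) (T : ℕ) (q : ℕ → ℤ × ℤ) : ℕ :=
  ((Finset.range T).filter fun t => IsAmbStep g (q t) (q (t + 1))).card

/-- Number of explicit moves along a path. -/
def expCount (g : Fin 2 → ℤ × ℤ) (T : ℕ) (q : ℕ → ℤ × ℤ) : ℕ :=
  ((Finset.range T).filter fun t => IsExpStep g (q t) (q (t + 1))).card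

/-- `n^a(p)`: minimum number of ambiguous moves over paths from `p` to a goal. -/
def naN (g : Fin 2 → ℤ × ℤ) (p : ℤ × ℤ) : ℕ :=
  sInf {n : ℕ | ∃ i : Fin 2, ∃ T q, IsPath p (g i) T q ∧ ambCount g T q = n}

/-- `n^r_i(p)`: minimum number of explicit moves needed to reach `g i` from `p`. -/
def nrN (g : Fin 2 → ℤ × ℤ) (i : Fin 2) (p : ℤ × ℤ) : ℕ :=
  sInf {n : ℕ | ∃ T q, IsPath p (g i) T q ∧ expCount g T q = n}

/-- The equilibrium Eater strategy `π^{E*}`: after an ambiguous Mover move the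
conservative action (based on the sign of `δ̃c₁`), after an explicit move the
exploiting action (eat from the approached goal). -/
def piEstar (g : Fin 2 → ℤ × ℤ) : EaterStrategy := fun p' a b =>
  let p := p' - a
  let d1 := mdist p' (g 0) - mdist p (g 0)
  let d2 := mdist p' (g 1) - mdist p (g 1)
  if d1 = d2 then
    if (b 0 + (mdist p' (g 0) : ℝ)) - (b 1 + (mdist p' (g 1) : ℝ)) < 0 then eatOne 0
    else if 0 < (b 0 + (mdist p' (g 0) : ℝ)) - (b 1 + (mdist p' (g 1) : ℝ)) then eatOne 1
    else eatHalf
  else if d1 < d2 then eatOne 0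
  else eatOne 1

/-- `π^{M*}_i`: the Mover strategy that (against any Eater strategy) follows a shortest
path from `p0` to `g i`, performing all `n^a(p0)` ambiguous moves first and then the
explicit moves. -/
def IsMoverStar (g : Fin 2 → ℤ × ℤ) (i : Fin 2) (p0 : ℤ × ℤ) (b0 : Fin 2 → ℝ)
    (piM : MoverStrategy) : Prop :=
  ValidMover piM ∧
  ∀ piE : EaterStrategy, ValidEater piE →
    (traj piM piE p0 b0 (mdist p0 (g i)).toNat).1 = g i ∧
    ∀ t < (mdist p0 (g i)).toNat,
      (IsAmbStep g (traj piM piE p0 b0 t).1 (traj piM piE p0 b0 (t + 1)).1 ↔ t < naN g p0)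

/-- `c_i(p, b) = b_i + d(p, g_i)`. -/
def cval (g : Fin 2 → ℤ × ℤ) (i : Fin 2) (p : ℤ × ℤ) (b : Fin 2 → ℝ) : ℝ :=
  b i + (mdist p (g i) : ℝ)

/-- `δc_i = c_i − c_{3−i}`. -/
def dcval (g : Fin 2 → ℤ × ℤ) (i : Fin 2) (p : ℤ × ℤ) (b : Fin 2 → ℝ) : ℝ :=
  cval g i p b - cval g (1 - i) p b

end

noncomputable def stepF (x : ℝ) : ℝ := if x < 0 then x + 1 else if 0 < x then x - 1 else x

noncomputable def gainF (x : ℝ) : ℝ := if x < 0 then 0 else if 0 < x then 1 else 1 / 2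

noncomputable def totG : ℕ → ℝ → ℝ
  | 0, _ => 0
  | n + 1, x => gainF x + totG n (stepF x)

lemma totG_succ_bounds (n : ℕ) : ∀ x, totG n x ≤ totG (n + 1) x ∧ totG (n + 1) x ≤ totG n x + 1 := by
  induction n with
  | zero =>
    intro x
    simp only [totG, gainF]
    split_ifs <;> norm_num
  | succ n ih =>
    intro x
    have h := ih (stepF x)
    have e1 : totG (n + 1 + 1) x = gainF x + totG (n + 1) (stepF x) := rfl
    have e2 : totG (n + 1) x = gainF x + totG n (stepF x) := rfl
    rw [e1, e2]
    constructor <;> linarith [h.1, h.2]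

lemma totG_shift (n : ℕ) (x : ℝ) : totG n (x - 1) ≤ totG n x := by
  cases n with
  | zero => simp [totG]
  | succ n =>
    by_cases hx : 0 < x
    · have h1 := (totG_succ_bounds n (x - 1)).2
      have h2 : totG (n + 1) x = 1 + totG n (x - 1) := by
        simp [totG, gainF, stepF, hx, not_lt.mpr hx.le]
      linarith
    · have h0 : x - 1 < 0 := by linarith
      have h2 : totG (n + 1) (x - 1) = totG n x := by
        simp only [totG, gainF, stepF, if_pos h0]
        simp
      rw [h2]
      exact (totG_succ_bounds n x).1

lemma seq_lower (T : ℕ) : ∀ (x c : ℕ → ℝ) (e : ℕ → ℤ),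
    (∀ t < T, (x (t+1) = stepF (x t) ∧ c (t+1) = c t - gainF (x t) ∧ e (t+1) = e t - 1) ∨
      (x (t+1) = x t - 1 ∧ c (t+1) = c t ∧ e (t+1) = e t + 1)) →
    ∃ n : ℕ, 2 * (n : ℤ) = e 0 - e T + T ∧ c 0 - totG n (x 0) ≤ c T := by
  induction T with
  | zero => intro x c e _; exact ⟨0, by simp, by simp [totG]⟩
  | succ T ih =>
    intro x c e h
    obtain ⟨n, hn, hc⟩ := ih (fun t => x (t+1)) (fun t => c (t+1)) (fun t => e (t+1))
      (fun t ht => h (t+1) (by omega))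
    simp only [zero_add] at hn hc
    rcases h 0 (by omega) with ⟨h1, h2, h3⟩ | ⟨h1, h2, h3⟩ <;> simp only [zero_add] at h1 h2 h3
    · refine ⟨n + 1, by push_cast; omega, ?_⟩
      rw [totG, ← h1]; linarith
    · refine ⟨n, by push_cast; omega, ?_⟩
      have := totG_shift n (x 0)
      rw [h1] at hc; linarith

lemma seq_star (T : ℕ) : ∀ (N : ℕ) (x c : ℕ → ℝ) (e : ℕ → ℤ),
    (∀ t < T, (t < N ∧ x (t+1) = stepF (x t) ∧ c (t+1) = c t - gainF (x t) ∧ e (t+1) = e t - 1) ∨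
      (¬ t < N ∧ x (t+1) = x t - 1 ∧ c (t+1) = c t ∧ e (t+1) = e t + 1)) →
    ∃ n : ℕ, n ≤ N ∧ 2 * (n : ℤ) = e 0 - e T + T ∧ c T = c 0 - totG n (x 0) := by
  induction T with
  | zero => intro N x c e _; exact ⟨0, by simp, by simp, by simp [totG]⟩
  | succ T ih =>
    intro N x c e h
    obtain ⟨n, hN, hn, hc⟩ := ih (N - 1) (fun t => x (t+1)) (fun t => c (t+1)) (fun t => e (t+1))
      (fun t ht => by
        rcases h (t+1) (by omega) with ⟨h0, h'⟩ | ⟨h0, h'⟩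
        · exact Or.inl ⟨by omega, h'⟩
        · exact Or.inr ⟨by omega, h'⟩)
    simp only [zero_add] at hn hc
    rcases h 0 (by omega) with ⟨h0, h1, h2, h3⟩ | ⟨h0, h1, h2, h3⟩ <;>
      simp only [zero_add] at h1 h2 h3
    · refine ⟨n + 1, by omega, by push_cast; omega, ?_⟩
      rw [totG, ← h1]; linarith
    · have : n = 0 := by omega
      subst this
      refine ⟨0, by omega, by push_cast; omega, ?_⟩
      simp only [totG] at hc ⊢; linarith

lemma mdist_step (p m q : ℤ × ℤ) (hm : IsUnitMove m) :
    mdist (p + m) q = mdist p q - 1 ∨ mdist (p + m) q = mdist p q + 1 := by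
  obtain ⟨a, b⟩ := p
  obtain ⟨u, v⟩ := q
  unfold mdist
  rcases hm with rfl | rfl | rfl | rfl <;> simp only [Prod.mk_add_mk] <;>
    rcases abs_cases (a - u) with h1 | h1 <;> rcases abs_cases (b - v) with h2 | h2 <;>
    grind

lemma mdist_self' (p : ℤ × ℤ) : mdist p p = 0 := by simp [mdist]

lemma D_step (D : ℕ → ℤ) (T : ℕ) (h0 : D 0 = T) (hT : D T = 0)
    (h : ∀ t, D t - 1 ≤ D (t+1)) : ∀ t ≤ T, D t = T - t := by
  have h2 : ∀ t k : ℕ, D t - k ≤ D (t + k) := by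
    intro t k
    induction k with
    | zero => simp
    | succ k ih => have := h (t + k); rw [← add_assoc]; push_cast; omega
  intro t ht
  have a := h2 0 t
  have b := h2 t (T - t)
  rw [Nat.add_sub_cancel' ht] at b
  rw [zero_add] at a
  omega

lemma valid_piEstar (g : Fin 2 → ℤ × ℤ) : ValidEater (piEstar g) := by
  intro p a b
  unfold piEstar IsEaterAction
  dsimp only
  split_ifs <;> simp

/-- one step of the game against `piEstar` along a move approaching `g i`. -/
lemma game_step (g : Fin 2 → ℤ × ℤ) (i : Fin 2) (p m : ℤ × ℤ) (b b' : Fin 2 → ℝ)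
    (hm : IsUnitMove m) (hd : mdist (p + m) (g i) = mdist p (g i) - 1)
    (hb : b' = fun j => b j + piEstar g (p + m) m b j) :
    (IsAmbStep g p (p + m) ∧ dcval g i (p + m) b' = stepF (dcval g i p b) ∧
      cval g i (p + m) b' = cval g i p b - gainF (dcval g i p b) ∧
      mdist (p + m) (g (1 - i)) = mdist p (g (1 - i)) - 1) ∨
    (¬ IsAmbStep g p (p + m) ∧ dcval g i (p + m) b' = dcval g i p b - 1 ∧
      cval g i (p + m) b' = cval g i p b ∧
      mdist (p + m) (g (1 - i)) = mdist p (g (1 - i)) + 1) := by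
  subst hb
  have hj := mdist_step p m (g (1 - i)) hm
  unfold IsAmbStep dcval cval piEstar stepF gainF
  simp only [add_sub_cancel_right]
  fin_cases i
  · simp only [Fin.zero_eta, sub_zero] at hd hj ⊢
    rcases hj with hj | hj
    · left
      rw [hd, hj]
      refine ⟨by ring, ?_⟩
      simp only [sub_sub_cancel_left, if_true]
      push_cast
      split_ifs <;> first | (exfalso; linarith) | (simp [eatOne, eatHalf]; try constructor) <;> linarith
    · right
      rw [hd, hj]
      refine ⟨by omega, ?_⟩
      rw [if_neg (by omega), if_pos (by omega)]
      push_cast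
      simp [eatOne]; ring
  · simp only [Fin.mk_one, sub_self] at hd hj ⊢
    rcases hj with hj | hj
    · left
      rw [hd, hj]
      refine ⟨by ring, ?_⟩
      simp only [sub_sub_cancel_left, if_true]
      push_cast
      split_ifs <;> first | (exfalso; linarith) | (simp [eatOne, eatHalf]; try constructor) <;> linarith
    · right
      rw [hd, hj]
      refine ⟨by omega, ?_⟩
      rw [if_neg (by omega), if_neg (by omega)]
      push_cast
      simp [eatOne]; ring

lemma traj_D (g : Fin 2 → ℤ × ℤ) (i : Fin 2) (p0 : ℤ × ℤ) (b0 : Fin 2 → ℝ)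
    (piM : MoverStrategy) (hM : ValidMover piM) (T : ℕ) (hT : (T : ℤ) = mdist p0 (g i))
    (hreach : (traj piM (piEstar g) p0 b0 T).1 = g i) :
    ∀ t ≤ T, mdist (traj piM (piEstar g) p0 b0 t).1 (g i) = T - t := by
  apply D_step (fun t => mdist (traj piM (piEstar g) p0 b0 t).1 (g i)) T
  · exact hT.symm
  · simp only [hreach, mdist_self']
  · intro t
    rcases mdist_step (traj piM (piEstar g) p0 b0 t).1 _ (g i)
      (hM (traj piM (piEstar g) p0 b0 t).1 (traj piM (piEstar g) p0 b0 t).2) with h | h <;>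
    simp only [traj] <;> omega

lemma traj_step (g : Fin 2 → ℤ × ℤ) (i : Fin 2) (p0 : ℤ × ℤ) (b0 : Fin 2 → ℝ)
    (piM : MoverStrategy) (hM : ValidMover piM) (T : ℕ) (hT : (T : ℤ) = mdist p0 (g i))
    (hreach : (traj piM (piEstar g) p0 b0 T).1 = g i) (t : ℕ) (ht : t < T) :
    (IsAmbStep g (traj piM (piEstar g) p0 b0 t).1 (traj piM (piEstar g) p0 b0 (t + 1)).1 ∧
      dcval g i (traj piM (piEstar g) p0 b0 (t + 1)).1 (traj piM (piEstar g) p0 b0 (t + 1)).2 = stepF (dcval g i (traj piM (piEstar g) p0 b0 t).1 (traj piM (piEstar g) p0 b0 t).2) ∧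
      cval g i (traj piM (piEstar g) p0 b0 (t + 1)).1 (traj piM (piEstar g) p0 b0 (t + 1)).2 = cval g i (traj piM (piEstar g) p0 b0 t).1 (traj piM (piEstar g) p0 b0 t).2 - gainF (dcval g i (traj piM (piEstar g) p0 b0 t).1 (traj piM (piEstar g) p0 b0 t).2) ∧
      mdist (traj piM (piEstar g) p0 b0 (t + 1)).1 (g (1 - i)) = mdist (traj piM (piEstar g) p0 b0 t).1 (g (1 - i)) - 1) ∨
    (¬ IsAmbStep g (traj piM (piEstar g) p0 b0 t).1 (traj piM (piEstar g) p0 b0 (t + 1)).1 ∧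
      dcval g i (traj piM (piEstar g) p0 b0 (t + 1)).1 (traj piM (piEstar g) p0 b0 (t + 1)).2 = dcval g i (traj piM (piEstar g) p0 b0 t).1 (traj piM (piEstar g) p0 b0 t).2 - 1 ∧
      cval g i (traj piM (piEstar g) p0 b0 (t + 1)).1 (traj piM (piEstar g) p0 b0 (t + 1)).2 = cval g i (traj piM (piEstar g) p0 b0 t).1 (traj piM (piEstar g) p0 b0 t).2 ∧
      mdist (traj piM (piEstar g) p0 b0 (t + 1)).1 (g (1 - i)) = mdist (traj piM (piEstar g) p0 b0 t).1 (g (1 - i)) + 1) :=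
  game_step g i (traj piM (piEstar g) p0 b0 t).1
    (piM (traj piM (piEstar g) p0 b0 t).1 (traj piM (piEstar g) p0 b0 t).2)
    (traj piM (piEstar g) p0 b0 t).2 (traj piM (piEstar g) p0 b0 (t+1)).2
    (hM _ _)
    (by
      have h1 := traj_D g i p0 b0 piM hM T hT hreach t (by omega)
      have h2 := traj_D g i p0 b0 piM hM T hT hreach (t+1) (by omega)
      simp only [traj] at h2
      push_cast at h2
      omega)
    rfl

/-- Ambiguous Moves First: among shortest paths, performing all ambiguous
moves first minimizes the consumption at the true goal against `π^{E*}`. -/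
theorem ambiguous_moves_first
    (g : Fin 2 → ℤ × ℤ) (hg : g 0 ≠ g 1) (p0 : ℤ × ℤ) (b0 : Fin 2 → ℝ)
    (hb0 : ∀ j, 0 ≤ b0 j) (i : Fin 2)
    (piM : MoverStrategy) (hM : ValidMover piM)
    (hadm : Reaches piM (piEstar g) p0 b0 (g i))
    (hshort : (hitTime piM (piEstar g) p0 b0 (g i) : ℤ) = mdist p0 (g i))
    (piMstar : MoverStrategy) (hstar : IsMoverStar g i p0 b0 piMstar) :
    outcome g i piMstar (piEstar g) p0 b0 ≤ outcome g i piM (piEstar g) p0 b0 := by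
  have hS1 : (traj piM (piEstar g) p0 b0 (hitTime piM (piEstar g) p0 b0 (g i))).1 = g i :=
    Nat.sInf_mem hadm
  obtain ⟨hMs, hs⟩ := hstar
  obtain ⟨hS2, hamb⟩ := hs _ (valid_piEstar g)
  obtain ⟨T, hTdef⟩ : ∃ T, T = hitTime piM (piEstar g) p0 b0 (g i) := ⟨_, rfl⟩
  rw [← hTdef] at hS1 hshort
  have hTn : (mdist p0 (g i)).toNat = T := by omega
  rw [hTn] at hS2 hamb
  have hT2 : hitTime piMstar (piEstar g) p0 b0 (g i) = T := by
    apply le_antisymm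
    · exact Nat.sInf_le hS2
    · have hmem : (traj piMstar (piEstar g) p0 b0
          (hitTime piMstar (piEstar g) p0 b0 (g i))).1 = g i :=
        Nat.sInf_mem (s := {t | (traj piMstar (piEstar g) p0 b0 t).1 = g i}) ⟨T, hS2⟩
      by_contra hlt
      have := traj_D g i p0 b0 piMstar hMs T hshort hS2 _ (not_le.mp hlt).le
      rw [hmem, mdist_self'] at this
      omega
  unfold outcome
  rw [hT2, ← hTdef]
  obtain ⟨n, hn, hc⟩ := seq_lower T
    (fun t => dcval g i (traj piM (piEstar g) p0 b0 t).1 (traj piM (piEstar g) p0 b0 t).2)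
    (fun t => cval g i (traj piM (piEstar g) p0 b0 t).1 (traj piM (piEstar g) p0 b0 t).2)
    (fun t => mdist (traj piM (piEstar g) p0 b0 t).1 (g (1 - i)))
    (fun t ht => (traj_step g i p0 b0 piM hM T hshort hS1 t ht).imp And.right And.right)
  obtain ⟨n', -, hn', hc'⟩ := seq_star T (naN g p0)
    (fun t => dcval g i (traj piMstar (piEstar g) p0 b0 t).1 (traj piMstar (piEstar g) p0 b0 t).2)
    (fun t => cval g i (traj piMstar (piEstar g) p0 b0 t).1 (traj piMstar (piEstar g) p0 b0 t).2)
    (fun t => mdist (traj piMstar (piEstar g) p0 b0 t).1 (g (1 - i)))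
    (fun t ht => (traj_step g i p0 b0 piMstar hMs T hshort hS2 t ht).imp
      (fun h => ⟨(hamb t ht).mp h.1, h.2⟩) (fun h => ⟨fun h' => h.1 ((hamb t ht).mpr h'), h.2⟩))
  simp only [hS1, hS2] at hn hn' hc hc'
  have : n = n' := by
    simp only [traj] at hn hn'
    omega
  subst this
  simp only [cval, mdist_self', traj] at hc hc'
  simp only [Int.cast_zero, add_zero] at hc hc'
  linarith
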